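/- Let V = V_d(p) with d ≥ 1 and p prime, and let S = (V, 𝓛) be a G-affine proper partial linear space where G is an affine permutation group of rank 3 on V. Let L ∈ 𝓛 be a line containing the zero vector. Then: (i) if x, y ∈ L \ {0} with x ≠ y, then y − x lies in the orbit x^{G_0} of x under the zero-stabilizer G_0; (ii) if x, y ∈ L \ {0} with x ≠ y, then the orbit y^{G_{0,x}} of y under the stabilizer in G_0 of x is contained in L \ {0}. -/

import Mathlib

open scoped Pointwise

/-- A partial linear space on the point set `P`: a set of lines (subsets of `P`) such that
any two distinct points lie on at most one common line and every line has at least two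
points. -/
structure PLS (P : Type*) where
  lines : Set (Set P)
  two_le_ncard : ∀ L ∈ lines, 2 ≤ L.ncard
  unique_of_pair : ∀ L₁ ∈ lines, ∀ L₂ ∈ lines, ∀ x y : P,
    x ≠ y → x ∈ L₁ → y ∈ L₁ → x ∈ L₂ → y ∈ L₂ → L₁ = L₂

namespace PLS

variable {P : Type*}

/-- Two points are collinear if they are distinct and lie on a common line. -/
def Collinear (S : PLS P) (x y : P) : Prop :=
  x ≠ y ∧ ∃ L ∈ S.lines, x ∈ L ∧ y ∈ L

/-- The set of points collinear with `x`. -/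
def nbrs (S : PLS P) (x : P) : Set P :=
  {y : P | S.Collinear x y}

/-- A linear space: any two distinct points lie on exactly one line. -/
def IsLinearSpace (S : PLS P) : Prop :=
  ∀ x y : P, x ≠ y → ∃! L, L ∈ S.lines ∧ x ∈ L ∧ y ∈ L

/-- A graph: every line has exactly two points. -/
def IsGraph (S : PLS P) : Prop :=
  ∀ L ∈ S.lines, L.ncard = 2

/-- Proper: neither a linear space nor a graph. -/
def IsProper (S : PLS P) : Prop :=
  ¬ S.IsLinearSpace ∧ ¬ S.IsGraph

/-- The automorphism group of `S`: all permutations of the point set mapping the line set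
onto itself. -/
def aut (S : PLS P) : Subgroup (Equiv.Perm P) :=
  MulAction.stabilizer (Equiv.Perm P) S.lines

end PLS

/-- The orbit of `x` under the stabiliser of `0` in `G`. -/
def zeroStabOrbit {V : Type*} [AddCommGroup V] (G : Subgroup (Equiv.Perm V)) (x : V) : Set V :=
  {y : V | ∃ g ∈ G, g 0 = 0 ∧ g x = y}

/-- `G` is an affine permutation group on `V`: it contains all translations, and every
element fixing `0` is additive. -/
def IsAffinePermGroup {V : Type*} [AddCommGroup V] (G : Subgroup (Equiv.Perm V)) : Prop :=
  (∀ v : V, Equiv.addRight v ∈ G) ∧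
    ∀ g ∈ G, g 0 = 0 → ∀ x y : V, g (x + y) = g x + g y

/-- The stabiliser of `0` in `G` has exactly two orbits on the set of nonzero vectors;
for an affine permutation group this says exactly that `G` has rank `3`. -/
def HasTwoZeroStabOrbits {V : Type*} [AddCommGroup V] (G : Subgroup (Equiv.Perm V)) : Prop :=
  ∃ x y : V, x ≠ 0 ∧ y ≠ 0 ∧ zeroStabOrbit G x ≠ zeroStabOrbit G y ∧
    ∀ z : V, z ≠ 0 → z ∈ zeroStabOrbit G x ∪ zeroStabOrbit G y

namespace PLS

variable {P : Type*} {S : PLS P}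

theorem image_mem_lines {g : Equiv.Perm P} (hg : g ∈ S.aut) {L : Set P} (hL : L ∈ S.lines) :
    g • L ∈ S.lines := by
  have hstab : g • S.lines = S.lines := hg
  rw [← hstab]
  exact Set.smul_mem_smul_set hL

theorem Collinear.map {g : Equiv.Perm P} (hg : g ∈ S.aut) {x y : P} (h : S.Collinear x y) :
    S.Collinear (g x) (g y) := by
  obtain ⟨hne, L, hL, hx, hy⟩ := h
  exact ⟨g.injective.ne hne, g • L, image_mem_lines hg hL, Set.smul_mem_smul_set hx,
    Set.smul_mem_smul_set hy⟩

theorem exists_not_collinear (h : ¬ S.IsLinearSpace) : ∃ x y, x ≠ y ∧ ¬ S.Collinear x y := by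
  contrapose! h
  intro x y hxy
  obtain ⟨-, L, hL, hx, hy⟩ := h x y hxy
  exact ⟨L, ⟨hL, hx, hy⟩, fun M ⟨hM, hx', hy'⟩ =>
    S.unique_of_pair M hM L hL x y hxy hx' hy' hx hy⟩

/-- An automorphism fixing two points of a line maps the line to itself. -/
theorem apply_mem_of_fixed {g : Equiv.Perm P} (hg : g ∈ S.aut) {L : Set P} (hL : L ∈ S.lines)
    {a b c : P} (hab : a ≠ b) (ha : a ∈ L) (hb : b ∈ L) (hc : c ∈ L)
    (hga : g a = a) (hgb : g b = b) : g c ∈ L := by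
  have hmem : ∀ {z}, z ∈ L → g z ∈ g • L := fun hz => Set.smul_mem_smul_set hz
  rw [S.unique_of_pair L hL (g • L) (image_mem_lines hg hL) a b hab ha hb
    (hga ▸ hmem ha) (hgb ▸ hmem hb)]
  exact hmem hc

end PLS

section Orbits

variable {V : Type*} [AddCommGroup V] {G : Subgroup (Equiv.Perm V)}

theorem zeroStabOrbit_trans_symm {a x y : V} (hx : x ∈ zeroStabOrbit G a)
    (hy : y ∈ zeroStabOrbit G a) : y ∈ zeroStabOrbit G x := by
  obtain ⟨g, hg, hg0, rfl⟩ := hx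
  obtain ⟨h, hh, hh0, rfl⟩ := hy
  refine ⟨h * g⁻¹, G.mul_mem hh (G.inv_mem hg), ?_, by simp⟩
  rw [Equiv.Perm.mul_apply, Equiv.Perm.inv_eq_iff_eq.mpr hg0.symm, hh0]

theorem PLS.Collinear.of_mem_zeroStabOrbit {S : PLS V} (hG : G ≤ S.aut) {x y : V}
    (hx : S.Collinear 0 x) (hy : y ∈ zeroStabOrbit G x) : S.Collinear 0 y := by
  obtain ⟨g, hg, hg0, rfl⟩ := hy
  simpa only [hg0] using hx.map (hG hg)

theorem PLS.Collinear.zero_sub {S : PLS V} (hG : G ≤ S.aut) (haff : IsAffinePermGroup G)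
    {x y : V} (h : S.Collinear x y) : S.Collinear 0 (y - x) := by
  simpa [sub_eq_add_neg] using h.map (hG (haff.1 (-x)))

/-- If some two points are not collinear, the points collinear with `0` form a single orbit
of the stabiliser of `0`. -/
theorem PLS.Collinear.mem_zeroStabOrbit {S : PLS V} (hS : ¬ S.IsLinearSpace) (hG : G ≤ S.aut)
    (haff : IsAffinePermGroup G) (hrank : HasTwoZeroStabOrbits G) {x y : V}
    (hx : S.Collinear 0 x) (hy : S.Collinear 0 y) : y ∈ zeroStabOrbit G x := by
  obtain ⟨u, v, huv, hnot⟩ := PLS.exists_not_collinear hS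
  have hz : ¬ S.Collinear 0 (v - u) := fun h => hnot <| by
    simpa using h.map (hG (haff.1 u))
  obtain ⟨a, b, -, -, -, hcover⟩ := hrank
  rcases hcover x hx.1.symm with hxa | hxb <;> rcases hcover y hy.1.symm with hya | hyb <;>
    rcases hcover (v - u) (sub_ne_zero.mpr huv.symm) with hza | hzb
  all_goals first
    | exact zeroStabOrbit_trans_symm ‹x ∈ _› ‹y ∈ _›
    | exact absurd (hx.of_mem_zeroStabOrbit hG (zeroStabOrbit_trans_symm ‹x ∈ _› ‹v - u ∈ _›)) hz
    | exact absurd (hy.of_mem_zeroStabOrbit hG (zeroStabOrbit_trans_symm ‹y ∈ _› ‹v - u ∈ _›)) hz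

end Orbits

/-- **Lemma 2.18.** Let `S = (V, 𝓛)` be a `G`-affine proper partial linear space for a
rank 3 affine permutation group `G` on `V = V_d(p)` and let `L` be a line through `0`.
(i) For distinct `x, y ∈ L \ {0}`, the difference `y - x` lies in the `G₀`-orbit of `x`;
(ii) for such `x, y`, the orbit of `y` under the stabiliser of `x` in `G₀` is contained in
`L \ {0}`. -/
theorem basic_line_lemma
    {p d : ℕ} (hp : p.Prime) (hd : 1 ≤ d)
    (V : Type*) [AddCommGroup V] [Module (ZMod p) V] [Finite V]
    (hdim : Module.finrank (ZMod p) V = d)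
    (S : PLS V) (hproper : S.IsProper)
    (G : Subgroup (Equiv.Perm V)) (hG : G ≤ S.aut)
    (haff : IsAffinePermGroup G) (hrank : HasTwoZeroStabOrbits G)
    (L : Set V) (hL : L ∈ S.lines) (h0 : (0 : V) ∈ L) :
    (∀ x ∈ L, ∀ y ∈ L, x ≠ 0 → y ≠ 0 → x ≠ y → y - x ∈ zeroStabOrbit G x) ∧
    (∀ x ∈ L, ∀ y ∈ L, x ≠ 0 → y ≠ 0 → x ≠ y →
      ∀ g ∈ G, g 0 = 0 → g x = x → g y ∈ L ∧ g y ≠ 0) := by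
  refine ⟨fun x hx y hy hx0 _ hxy => ?_, fun x hx y hy hx0 hy0 _ g hg hg0 hgx => ⟨?_, ?_⟩⟩
  · have h0x : S.Collinear 0 x := ⟨hx0.symm, L, hL, h0, hx⟩
    have hxy' : S.Collinear x y := ⟨hxy, L, hL, hx, hy⟩
    exact h0x.mem_zeroStabOrbit hproper.1 hG haff hrank (hxy'.zero_sub hG haff)
  · exact PLS.apply_mem_of_fixed (hG hg) hL hx0.symm h0 hx hy hg0 hgx
  · exact fun h => hy0 (g.injective (h.trans hg0.symm))
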